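/- arXiv:1810.06372 — 3 statements merged into one kernel-verified Lean document; each statement's English description precedes it below -/
import Mathlib

section
/- For every x > 0 and every τ ∈ ℝ, the kernel 𝒦(x,τ) admits the Fourier-cosine representation 𝒦(x,τ) = ∫_0^∞ K_0(4·x^{1/4}·(cosh u)^{1/2})·cos(2uτ) du, where K_0(y) = ∫_0^∞ exp(−y·cosh t) dt. -/
open MeasureTheory Set Filter Asymptotics

/-- Modified Bessel function of the second kind (integral representation, for Re z > 0). -/
noncomputable def besselK (nu z : ℂ) : ℂ :=
  ∫ t in Set.Ioi (0:ℝ), Complex.exp (-z * (Real.cosh t : ℂ)) * Complex.cosh (nu * (t : ℂ))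

/-- The kernel 𝒦(x,τ) = ker²_{2iτ}(2(4x)^{1/4}) + kei²_{2iτ}(2(4x)^{1/4})
    = K_{2iτ}(2(4x)^{1/4}e^{iπ/4}) · K_{2iτ}(2(4x)^{1/4}e^{-iπ/4}), which is real. -/
noncomputable def kernelK (x τ : ℝ) : ℝ :=
  (besselK (2 * Complex.I * (τ:ℂ))
      (((2 * (4*x) ^ ((1:ℝ)/4) : ℝ) : ℂ) * Complex.exp (Complex.I * (Real.pi:ℂ) / 4)) *
   besselK (2 * Complex.I * (τ:ℂ))
      (((2 * (4*x) ^ ((1:ℝ)/4) : ℝ) : ℂ) * Complex.exp (-(Complex.I * (Real.pi:ℂ)) / 4))).re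

/-- K₀(y) = ∫₀^∞ exp(−y·cosh t) dt. -/
noncomputable def besselK0 (y : ℝ) : ℝ := ∫ t in Set.Ioi (0:ℝ), Real.exp (-y * Real.cosh t)

/-- K_{iτ}(x) = ∫₀^∞ exp(−x·cosh t)·cos(τt) dt (real-valued, purely imaginary order). -/
noncomputable def besselKi (τ x : ℝ) : ℝ :=
  ∫ t in Set.Ioi (0:ℝ), Real.exp (-x * Real.cosh t) * Real.cos (τ * t)

/-- Modified Bessel function of the first kind I_ν(z) (power series). -/
noncomputable def besselI (nu z : ℂ) : ℂ :=
  ∑' n : ℕ, (z/2) ^ (nu + 2*(n:ℂ)) / ((n.factorial : ℂ) * Complex.Gamma (nu + (n:ℂ) + 1))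

/-- B_ν(w) = ber²_ν(w) + bei²_ν(w) = I_ν(w·e^{iπ/4})·I_ν(w·e^{−iπ/4}). -/
noncomputable def kelvinB (nu w : ℂ) : ℂ :=
  besselI nu (w * Complex.exp (Complex.I * (Real.pi:ℂ) / 4)) *
  besselI nu (w * Complex.exp (-(Complex.I * (Real.pi:ℂ)) / 4))

/-- Index transform (1.1): (F f)(τ) = ∫₀^∞ 𝒦(x,τ) f(x) dx. -/
noncomputable def indexF (f : ℝ → ℝ) (τ : ℝ) : ℝ := ∫ x in Set.Ioi (0:ℝ), kernelK x τ * f x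

/-- Index transform (1.2): (G g)(x) = ∫₀^∞ 𝒦(x,τ) g(τ) dτ. -/
noncomputable def indexG (g : ℝ → ℝ) (x : ℝ) : ℝ := ∫ τ in Set.Ioi (0:ℝ), kernelK x τ * g τ

/-- Index transform (1.2) for complex-valued densities. -/
noncomputable def indexGC (g : ℝ → ℂ) (x : ℝ) : ℂ :=
  ∫ τ in Set.Ioi (0:ℝ), (kernelK x τ : ℂ) * g τ

/-- Mellin transform of a real function. -/
noncomputable def mellinT (f : ℝ → ℝ) (s : ℂ) : ℂ :=
  ∫ x in Set.Ioi (0:ℝ), (f x : ℂ) * (x:ℂ) ^ (s - 1)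

/-- Mellin transform of a complex function. -/
noncomputable def mellinC (F : ℝ → ℂ) (s : ℂ) : ℂ :=
  ∫ x in Set.Ioi (0:ℝ), F x * (x:ℂ) ^ (s - 1)

/-- The L_{ν,p}(ℝ₊) norm. -/
noncomputable def Lnorm (ν p : ℝ) (f : ℝ → ℝ) : ℝ :=
  (∫ x in Set.Ioi (0:ℝ), |f x| ^ p * x ^ (ν*p - 1)) ^ (1/p)

/-- Euler beta function B(a,b) = Γ(a)Γ(b)/Γ(a+b). -/
noncomputable def betaFn (a b : ℝ) : ℝ := Real.Gamma a * Real.Gamma b / Real.Gamma (a+b)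

lemma Real.sq_div_four_le_cosh (t : ℝ) : t ^ 2 / 4 ≤ Real.cosh t := by
  have h := Real.quadratic_le_exp_of_nonneg (abs_nonneg t)
  rw [sq_abs] at h
  rw [← Real.cosh_abs, Real.cosh_eq]
  linarith [Real.exp_pos (-|t|), abs_nonneg t]

lemma integrable_exp_neg_mul_cosh {y : ℝ} (hy : 0 < y) :
    Integrable fun t : ℝ => Real.exp (-y * Real.cosh t) := by
  refine (integrable_exp_neg_mul_sq (b := y / 4) (by positivity)).mono'
    (by fun_prop) (ae_of_all _ fun t => ?_)
  rw [Real.norm_eq_abs, Real.abs_exp, Real.exp_le_exp]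
  nlinarith [Real.sq_div_four_le_cosh t]

lemma integrable_cosh_mul_exp_neg_mul_cosh {y : ℝ} (hy : 0 < y) :
    Integrable fun t : ℝ => Real.cosh t * Real.exp (-y * Real.cosh t) := by
  refine ((integrable_exp_neg_mul_cosh (half_pos hy)).const_mul (2 / y)).mono'
    (by fun_prop) (ae_of_all _ fun t => ?_)
  have hc := Real.cosh_pos t
  rw [Real.norm_of_nonneg (by positivity)]
  have h : Real.exp (-y * Real.cosh t)
      = Real.exp (-(y / 2) * Real.cosh t) * Real.exp (-(y / 2 * Real.cosh t)) := by
    rw [← Real.exp_add]; ring_nf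
  have h2 : y / 2 * Real.cosh t * Real.exp (-(y / 2 * Real.cosh t)) ≤ 1 := by
    rw [Real.exp_neg, ← div_eq_mul_inv, div_le_one (Real.exp_pos _)]
    linarith [Real.add_one_le_exp (y / 2 * Real.cosh t)]
  calc Real.cosh t * Real.exp (-y * Real.cosh t)
      = 2 / y * Real.exp (-(y / 2) * Real.cosh t) *
          (y / 2 * Real.cosh t * Real.exp (-(y / 2 * Real.cosh t))) := by
        rw [h]; field_simp
    _ ≤ 2 / y * Real.exp (-(y / 2) * Real.cosh t) := mul_le_of_le_one_right (by positivity) h2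

lemma Complex.norm_sinh_le_cosh_re (z : ℂ) : ‖Complex.sinh z‖ ≤ Real.cosh z.re := by
  rw [Complex.sinh, Real.cosh_eq, norm_div, Complex.norm_ofNat]
  gcongr
  refine (norm_sub_le _ _).trans_eq ?_
  simp [Complex.norm_exp]

lemma Complex.re_cosh_ofReal_add_mul_I (v φ : ℝ) :
    (Complex.cosh (v + φ * Complex.I)).re = Real.cosh v * Real.cos φ := by
  rw [Complex.cosh_add, Complex.cosh_mul_I, Complex.sinh_mul_I]
  rw [← mul_assoc, ← Complex.ofReal_cosh, ← Complex.ofReal_sinh, ← Complex.ofReal_cos,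
    ← Complex.ofReal_sin, ← Complex.ofReal_mul, ← Complex.ofReal_mul, Complex.add_re,
    Complex.ofReal_re, Complex.re_ofReal_mul, Complex.I_re, mul_zero, add_zero]

lemma integrable_cexp_neg_mul_cosh_add_mul_I {y φ : ℝ} (hy : 0 < y) (hφ : 0 < Real.cos φ) :
    Integrable fun v : ℝ => Complex.exp (-y * Complex.cosh (v + φ * Complex.I)) := by
  refine (integrable_exp_neg_mul_cosh (mul_pos hy hφ)).mono' (by fun_prop) (ae_of_all _ fun v => ?_)
  rw [Complex.norm_exp, ← Complex.ofReal_neg, Complex.re_ofReal_mul,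
    Complex.re_cosh_ofReal_add_mul_I]
  exact (congrArg Real.exp (by ring)).le

lemma hasDerivAt_integral_cexp_neg_mul_cosh_add_mul_I {y φ : ℝ} (hy : 0 < y)
    (hφ : 0 < Real.cos φ) :
    HasDerivAt (fun ψ : ℝ => ∫ v : ℝ, Complex.exp (-y * Complex.cosh (v + ψ * Complex.I)))
      0 φ := by
  set F' : ℝ → ℝ → ℂ := fun ψ v =>
    Complex.exp (-y * Complex.cosh (v + ψ * Complex.I)) *
      (-y * Complex.sinh (v + ψ * Complex.I)) with hF'
  have hv (ψ v : ℝ) : HasDerivAt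
      (fun v : ℝ => Complex.exp (-y * Complex.cosh (v + ψ * Complex.I))) (F' ψ v) v := by
    have h : HasDerivAt (fun v : ℝ => (v : ℂ) + ψ * Complex.I) 1 v :=
      Complex.ofRealCLM.hasDerivAt.add_const _
    simpa [hF'] using (((Complex.hasDerivAt_cosh _).comp v h).const_mul (-y : ℂ)).cexp
  have hd (ψ v : ℝ) : HasDerivAt
      (fun ψ : ℝ => Complex.exp (-y * Complex.cosh (v + ψ * Complex.I)))
      (F' ψ v * Complex.I) ψ := by
    have h : HasDerivAt (fun ψ : ℝ => (v : ℂ) + ψ * Complex.I) Complex.I ψ := by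
      simpa using ((Complex.ofRealCLM.hasDerivAt (x := ψ)).mul_const Complex.I).const_add (v : ℂ)
    simpa [hF', mul_assoc] using (((Complex.hasDerivAt_cosh _).comp ψ h).const_mul (-y : ℂ)).cexp
  have hs : {ψ | Real.cos φ / 2 < Real.cos ψ} ∈ nhds φ :=
    (isOpen_lt continuous_const Real.continuous_cos).mem_nhds
      (show Real.cos φ / 2 < Real.cos φ by linarith)
  have hb (v ψ : ℝ) (hψ : Real.cos φ / 2 < Real.cos ψ) : ‖F' ψ v * Complex.I‖ ≤
      y * (Real.cosh v * Real.exp (-(y * (Real.cos φ / 2)) * Real.cosh v)) := by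
    have hsinh := Complex.norm_sinh_le_cosh_re (v + ψ * Complex.I)
    simp only [Complex.add_re, Complex.ofReal_re, Complex.re_ofReal_mul, Complex.I_re, mul_zero,
      add_zero] at hsinh
    have hc := Real.cosh_pos v
    have hexp : ‖Complex.exp (-y * Complex.cosh (v + ψ * Complex.I))‖
        ≤ Real.exp (-(y * (Real.cos φ / 2)) * Real.cosh v) := by
      rw [Complex.norm_exp, ← Complex.ofReal_neg, Complex.re_ofReal_mul,
        Complex.re_cosh_ofReal_add_mul_I, Real.exp_le_exp]
      nlinarith [mul_lt_mul_of_pos_left hψ (mul_pos hy hc)]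
    rw [norm_mul, Complex.norm_I, mul_one, norm_mul, norm_mul, norm_neg, Complex.norm_real,
      Real.norm_of_nonneg hy.le]
    calc _ ≤ Real.exp (-(y * (Real.cos φ / 2)) * Real.cosh v) * (y * Real.cosh v) := by gcongr
      _ = _ := by ring
  obtain ⟨hint, hder⟩ := hasDerivAt_integral_of_dominated_loc_of_deriv_le
    (F := fun (ψ v : ℝ) => Complex.exp (-y * Complex.cosh (v + ψ * Complex.I)))
    (F' := fun ψ v => F' ψ v * Complex.I)
    (bound := fun v => y * (Real.cosh v * Real.exp (-(y * (Real.cos φ / 2)) * Real.cosh v)))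
    (μ := volume) hs (Eventually.of_forall fun ψ => by fun_prop)
    (integrable_cexp_neg_mul_cosh_add_mul_I hy hφ) (by simp only [hF']; fun_prop)
    (ae_of_all _ hb)
    ((integrable_cosh_mul_exp_neg_mul_cosh (mul_pos hy (half_pos hφ))).const_mul y)
    (ae_of_all _ fun v ψ _ => hd ψ v)
  have hint' : Integrable (F' φ) := by
    simpa [mul_assoc] using hint.mul_const (-Complex.I)
  have h0 := integral_eq_zero_of_hasDerivAt_of_integrable (hv φ) hint'
    (integrable_cexp_neg_mul_cosh_add_mul_I hy hφ)
  rwa [integral_mul_const, h0, zero_mul] at hder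

/-- Rotating the contour of integration does not change the integral defining `K₀`. -/
lemma integral_cexp_neg_mul_cosh_add_mul_I {y φ : ℝ} (hy : 0 < y) (hφ : |φ| < Real.pi / 2) :
    ∫ v : ℝ, Complex.exp (-y * Complex.cosh (v + φ * Complex.I)) = 2 * besselK0 y := by
  have hd : ∀ ψ ∈ Ioo (-(Real.pi / 2)) (Real.pi / 2), HasDerivAt
      (fun ψ : ℝ => ∫ v : ℝ, Complex.exp (-y * Complex.cosh (v + ψ * Complex.I))) 0 ψ :=
    fun ψ hψ => hasDerivAt_integral_cexp_neg_mul_cosh_add_mul_I hy (Real.cos_pos_of_mem_Ioo hψ)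
  have h := isOpen_Ioo.is_const_of_deriv_eq_zero isPreconnected_Ioo
    (fun ψ hψ => (hd ψ hψ).differentiableAt.differentiableWithinAt)
    (fun ψ hψ => (hd ψ hψ).deriv) (abs_lt.1 hφ)
    (⟨by linarith [Real.pi_pos], by positivity⟩ : (0 : ℝ) ∈ Ioo (-(Real.pi / 2)) (Real.pi / 2))
  have habs := integral_comp_abs (f := fun t => Real.exp (-y * Real.cosh t))
  simp only [Real.cosh_abs] at habs
  rw [h, besselK0, ← Complex.ofReal_ofNat, ← Complex.ofReal_mul, ← habs, ← integral_complex_ofReal]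
  simp

lemma integrable_cexp_neg_mul_cosh_mul_cexp {z : ℂ} (hz : 0 < z.re) (τ : ℝ) :
    Integrable fun t : ℝ => Complex.exp (-z * Real.cosh t) * Complex.exp (2 * Complex.I * τ * t) := by
  refine (integrable_exp_neg_mul_cosh hz).mono' (by fun_prop) (ae_of_all _ fun t => ?_)
  rw [norm_mul, Complex.norm_exp, Complex.norm_exp, mul_comm (-z), Complex.re_ofReal_mul,
    Complex.neg_re, show 2 * Complex.I * τ * t = ((2 * τ * t : ℝ) : ℂ) * Complex.I by
      push_cast; ring, Complex.re_ofReal_mul, Complex.I_re, mul_zero, Real.exp_zero, mul_one]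
  exact (congrArg Real.exp (by ring)).le

lemma besselK_two_mul_I_mul {z : ℂ} (hz : 0 < z.re) (τ : ℝ) :
    2 * besselK (2 * Complex.I * τ) z =
      ∫ t : ℝ, Complex.exp (-z * Real.cosh t) * Complex.exp (2 * Complex.I * τ * t) := by
  set f : ℝ → ℂ := fun t =>
    Complex.exp (-z * Real.cosh t) * Complex.exp (2 * Complex.I * τ * t) with hf
  have hi : Integrable f := integrable_cexp_neg_mul_cosh_mul_cexp hz τ
  have h := integral_add (hi.integrableOn (s := Ioi 0)) (hi.comp_neg.integrableOn (s := Ioi 0))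
  rw [integral_comp_neg_Ioi, neg_zero, add_comm, intervalIntegral.integral_Iic_add_Ioi
    hi.integrableOn hi.integrableOn] at h
  rw [← h, besselK, ← integral_const_mul]
  congr 1 with t
  simp only [hf, Complex.cosh, Real.cosh_neg, Complex.ofReal_neg, mul_neg]
  ring

lemma integral_cexp_neg_mul_cosh_add_conj {w : ℝ} (hw : 0 < w) (u : ℝ) :
    ∫ t : ℝ, Complex.exp (-(w * (1 + Complex.I)) * Real.cosh t) *
        Complex.exp (-(w * (1 - Complex.I)) * Real.cosh (u - t)) =
      2 * besselK0 (2 * w * Real.sqrt (Real.cosh u)) := by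
  set ζ : ℂ := ⟨Real.cosh (u / 2), Real.sinh (u / 2)⟩ with hζ
  have hn : ‖ζ‖ = Real.sqrt (Real.cosh u) := by
    rw [Complex.norm_def, Complex.normSq_mk, show u = 2 * (u / 2) by ring, Real.cosh_two_mul,
      mul_div_cancel_left₀ _ two_ne_zero, sq, sq]
  have harg : |ζ.arg| < Real.pi / 2 :=
    Complex.abs_arg_lt_pi_div_two_iff.2 (Or.inl (Real.cosh_pos _))
  have hre : (Real.cosh (u / 2) : ℂ) = ‖ζ‖ * Real.cos ζ.arg := by
    rw [← Complex.ofReal_mul, Complex.norm_mul_cos_arg]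
  have him : (Real.sinh (u / 2) : ℂ) = ‖ζ‖ * Real.sin ζ.arg := by
    rw [← Complex.ofReal_mul, Complex.norm_mul_sin_arg]
  have hpos : 0 < 2 * w * Real.sqrt (Real.cosh u) := by
    have := Real.cosh_pos u
    positivity
  rw [← integral_cexp_neg_mul_cosh_add_mul_I hpos harg, ← integral_add_right_eq_self _ (u / 2)]
  congr 1 with v
  rw [← Complex.exp_add, ← hn, show u - (v + u / 2) = u / 2 - v by ring, Real.cosh_sub,
    Real.cosh_add, Complex.cosh_add, Complex.cosh_mul_I, Complex.sinh_mul_I]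
  push_cast [-Complex.ofReal_cosh, -Complex.ofReal_sinh] at *
  rw [hre, him]
  push_cast
  congr 1
  ring

open Convolution in
lemma convolution_cexp_neg_mul_cosh {w : ℝ} (hw : 0 < w) (τ u : ℝ) :
    ((fun t : ℝ => Complex.exp (-(w * (1 + Complex.I)) * Real.cosh t) *
        Complex.exp (2 * Complex.I * τ * t)) ⋆[ContinuousLinearMap.mul ℝ ℂ, volume]
      (fun t : ℝ => Complex.exp (-(w * (1 - Complex.I)) * Real.cosh t) *
        Complex.exp (2 * Complex.I * τ * t))) u =
      2 * besselK0 (2 * w * Real.sqrt (Real.cosh u)) * Complex.exp (2 * Complex.I * τ * u) := by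
  rw [convolution_def, ← integral_cexp_neg_mul_cosh_add_conj hw, ← integral_mul_const]
  congr 1 with t
  rw [ContinuousLinearMap.mul_apply', show 2 * Complex.I * τ * u =
    2 * Complex.I * τ * t + 2 * Complex.I * τ * (u - t : ℝ) by push_cast; ring, Complex.exp_add]
  ring

lemma re_besselK_mul_besselK_conj {w : ℝ} (hw : 0 < w) (τ : ℝ) :
    (besselK (2 * Complex.I * τ) (w * (1 + Complex.I)) *
      besselK (2 * Complex.I * τ) (w * (1 - Complex.I))).re =
    ∫ u in Ioi (0 : ℝ), besselK0 (2 * w * Real.sqrt (Real.cosh u)) * Real.cos (2 * u * τ) := by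
  have h₁ : 0 < ((w : ℂ) * (1 + Complex.I)).re := by simpa using hw
  have h₂ : 0 < ((w : ℂ) * (1 - Complex.I)).re := by simpa using hw
  have hi₁ := integrable_cexp_neg_mul_cosh_mul_cexp h₁ τ
  have hi₂ := integrable_cexp_neg_mul_cosh_mul_cexp h₂ τ
  have hc := integral_convolution (ContinuousLinearMap.mul ℝ ℂ) hi₁ hi₂
  have hi := hi₁.integrable_convolution (ContinuousLinearMap.mul ℝ ℂ) hi₂
  rw [funext (convolution_cexp_neg_mul_cosh hw τ)] at hi
  simp_rw [convolution_cexp_neg_mul_cosh hw τ] at hc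
  rw [ContinuousLinearMap.mul_apply', ← besselK_two_mul_I_mul h₁,
    ← besselK_two_mul_I_mul h₂] at hc
  have hre (u : ℝ) : (2 * besselK0 (2 * w * Real.sqrt (Real.cosh u)) *
      Complex.exp (2 * Complex.I * τ * u)).re =
      2 * (besselK0 (2 * w * Real.sqrt (Real.cosh u)) * Real.cos (2 * u * τ)) := by
    rw [show 2 * Complex.I * τ * u = ((2 * u * τ : ℝ) : ℂ) * Complex.I by push_cast; ring,
      ← Complex.ofReal_ofNat, ← Complex.ofReal_mul, Complex.re_ofReal_mul,
      Complex.exp_ofReal_mul_I_re, mul_assoc]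
  have hr := integral_re hi
  simp only [RCLike.re_to_complex, hre, hc, integral_const_mul] at hr
  have habs := integral_comp_abs
    (f := fun u => besselK0 (2 * w * Real.sqrt (Real.cosh u)) * Real.cos (2 * u * τ))
  have hcos (u : ℝ) : Real.cos (2 * |u| * τ) = Real.cos (2 * u * τ) := by
    rcases abs_choice u with h | h <;> simp [h]
  simp only [Real.cosh_abs, hcos] at habs
  rw [habs, mul_mul_mul_comm, show (2 * 2 : ℂ) = ((4 : ℝ) : ℂ) by push_cast; norm_num,
    Complex.re_ofReal_mul] at hr
  linarith

lemma Complex.exp_I_mul_pi_div_four :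
    Complex.exp (Complex.I * Real.pi / 4) = (Real.sqrt 2 / 2 : ℝ) * (1 + Complex.I) := by
  rw [show Complex.I * Real.pi / 4 = ((Real.pi / 4 : ℝ) : ℂ) * Complex.I by push_cast; ring,
    Complex.exp_mul_I, ← Complex.ofReal_cos, ← Complex.ofReal_sin, Real.cos_pi_div_four,
    Real.sin_pi_div_four]
  ring

lemma Complex.exp_neg_I_mul_pi_div_four :
    Complex.exp (-(Complex.I * Real.pi) / 4) = (Real.sqrt 2 / 2 : ℝ) * (1 - Complex.I) := by
  rw [show -(Complex.I * Real.pi) / 4 = ((-(Real.pi / 4) : ℝ) : ℂ) * Complex.I by push_cast; ring,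
    Complex.exp_mul_I, ← Complex.ofReal_cos, ← Complex.ofReal_sin, Real.cos_neg, Real.sin_neg,
    Real.cos_pi_div_four, Real.sin_pi_div_four]
  push_cast
  ring

lemma two_mul_rpow_one_div_four_mul_sqrt_two {x : ℝ} (hx : 0 < x) :
    2 * (4 * x) ^ ((1 : ℝ) / 4) * (Real.sqrt 2 / 2) = 2 * x ^ ((1 : ℝ) / 4) := by
  have h : (4 : ℝ) ^ ((1 : ℝ) / 4) = Real.sqrt 2 := by
    rw [Real.sqrt_eq_rpow, show (4 : ℝ) = 2 ^ (2 : ℝ) by norm_num, ← Real.rpow_mul (by norm_num)]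
    norm_num
  rw [Real.mul_rpow (by norm_num) hx.le, h]
  linear_combination x ^ ((1 : ℝ) / 4) * Real.mul_self_sqrt (show (0 : ℝ) ≤ 2 by norm_num)

/-- Lemma 1: Fourier-cosine representation of the kernel. -/
theorem kernel_fourier_cosine_repr (x τ : ℝ) (hx : 0 < x) :
    kernelK x τ = ∫ u in Set.Ioi (0:ℝ),
      besselK0 (4 * x ^ ((1:ℝ)/4) * Real.sqrt (Real.cosh u)) * Real.cos (2 * u * τ) := by
  have hw : 0 < 2 * x ^ ((1 : ℝ) / 4) := by positivity
  rw [kernelK, Complex.exp_I_mul_pi_div_four, Complex.exp_neg_I_mul_pi_div_four, ← mul_assoc,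
    ← mul_assoc, ← Complex.ofReal_mul, two_mul_rpow_one_div_four_mul_sqrt_two hx,
    re_besselK_mul_besselK_conj hw]
  simp only [← mul_assoc]
  norm_num
end

section
/- For each fixed τ ∈ ℝ the function x ↦ 𝒦(x,τ) is four times differentiable on (0,∞) and satisfies the fourth-order ordinary differential equation x³·𝒦⁗(x,τ) + (11/2)·x²·𝒦‴(x,τ) + x·(11/2 + τ²)·𝒦″(x,τ) + (1/2)·(1 + τ²)·𝒦′(x,τ) − 𝒦(x,τ) = 0 for all x > 0, where primes denote derivatives with respect to x. -/
open MeasureTheory Set Filter Asymptotics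

/-- The moments `∫₀^∞ exp(-z cosh t) coshⁿ t cosh(ν t) dt`, equal to `(-1)ⁿ K_ν⁽ⁿ⁾(z)`. -/
noncomputable def besselKMoment (nu : ℂ) (n : ℕ) (z : ℂ) : ℂ :=
  ∫ t in Set.Ioi (0:ℝ),
    Complex.exp (-z * (Real.cosh t : ℂ)) * (Real.cosh t : ℂ) ^ n * Complex.cosh (nu * (t : ℂ))

lemma besselKMoment_zero (nu z : ℂ) : besselKMoment nu 0 z = besselK nu z := by
  simp [besselKMoment, besselK]

lemma norm_cosh_le_exp_norm (w : ℂ) : ‖Complex.cosh w‖ ≤ Real.exp ‖w‖ := by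
  have h1 := Complex.norm_exp_le_exp_norm w
  have h2 := Complex.norm_exp_le_exp_norm (-w)
  rw [norm_neg] at h2
  rw [Complex.cosh, norm_div, Complex.norm_ofNat]
  linarith [norm_add_le (Complex.exp w) (Complex.exp (-w))]

lemma norm_sinh_le_exp_norm (w : ℂ) : ‖Complex.sinh w‖ ≤ Real.exp ‖w‖ := by
  have h1 := Complex.norm_exp_le_exp_norm w
  have h2 := Complex.norm_exp_le_exp_norm (-w)
  rw [norm_neg] at h2
  rw [Complex.sinh, norm_div, Complex.norm_ofNat]
  linarith [norm_sub_le (Complex.exp w) (Complex.exp (-w))]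

lemma exp_le_two_mul_cosh (t : ℝ) : Real.exp t ≤ 2 * Real.cosh t := by
  rw [Real.cosh_eq]
  linarith [Real.exp_pos (-t)]

lemma self_le_cosh (t : ℝ) : t ≤ Real.cosh t := by
  rcases le_total 0 t with h | h
  · exact (Real.self_le_sinh_iff.2 h).trans (Real.sinh_lt_cosh t).le
  · exact h.trans (Real.cosh_pos t).le

lemma exp_norm_mul_le_cosh_pow (nu : ℂ) {t : ℝ} (ht : 0 ≤ t) :
    Real.exp ‖nu * (t : ℂ)‖ ≤ (2 * Real.cosh t) ^ ⌈‖nu‖⌉₊ := by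
  calc Real.exp ‖nu * (t : ℂ)‖ ≤ Real.exp (⌈‖nu‖⌉₊ * t) := by
        rw [norm_mul, Complex.norm_real, Real.norm_of_nonneg ht]
        gcongr
        exact Nat.le_ceil _
    _ = Real.exp t ^ ⌈‖nu‖⌉₊ := Real.exp_nat_mul _ _
    _ ≤ _ := by gcongr; exact exp_le_two_mul_cosh t

lemma norm_exp_neg_mul_cosh (z : ℂ) (t : ℝ) :
    ‖Complex.exp (-z * (Real.cosh t : ℂ))‖ = Real.exp (-z.re * Real.cosh t) := by
  rw [Complex.norm_exp, Complex.re_mul_ofReal, Complex.neg_re]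

lemma cosh_pow_mul_exp_isBigO (m : ℕ) {δ : ℝ} (hδ : 0 < δ) :
    (fun t : ℝ => Real.cosh t ^ m * Real.exp (-δ * Real.cosh t))
      =O[atTop] fun t => Real.exp (-(δ / 2) * t) := by
  have hcosh : Tendsto Real.cosh atTop atTop := tendsto_atTop_mono self_le_cosh tendsto_id
  have h := ((isLittleO_pow_exp_pos_mul_atTop m (half_pos hδ)).comp_tendsto hcosh).isBigO
  have h2 := h.mul (isBigO_refl (fun t => Real.exp (-δ * Real.cosh t)) atTop)
  refine h2.trans (IsBigO.of_bound 1 (Eventually.of_forall fun t => ?_))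
  simp only [Function.comp, ← Real.exp_add, Real.norm_eq_abs, Real.abs_exp, one_mul]
  gcongr
  nlinarith [self_le_cosh t]

lemma integrableOn_cosh_pow_mul_exp (m : ℕ) {δ : ℝ} (hδ : 0 < δ) :
    IntegrableOn (fun t : ℝ => Real.cosh t ^ m * Real.exp (-δ * Real.cosh t)) (Ioi 0) := by
  refine integrable_of_isBigO_exp_neg (half_pos hδ) ?_ (cosh_pow_mul_exp_isBigO m hδ)
  have := Real.continuous_cosh
  fun_prop

lemma tendsto_cosh_pow_mul_exp (m : ℕ) {δ : ℝ} (hδ : 0 < δ) :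
    Tendsto (fun t : ℝ => Real.cosh t ^ m * Real.exp (-δ * Real.cosh t)) atTop (nhds 0) := by
  refine (cosh_pow_mul_exp_isBigO m hδ).trans_tendsto ?_
  exact Real.tendsto_exp_atBot.comp (tendsto_id.const_mul_atTop_of_neg (by linarith))

lemma norm_besselKMoment_integrand_le (nu : ℂ) (n : ℕ) {z : ℂ} {δ : ℝ} (hz : δ ≤ z.re)
    {t : ℝ} (ht : 0 ≤ t) :
    ‖Complex.exp (-z * (Real.cosh t : ℂ)) * (Real.cosh t : ℂ) ^ n * Complex.cosh (nu * (t : ℂ))‖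
      ≤ 2 ^ ⌈‖nu‖⌉₊ * (Real.cosh t ^ (n + ⌈‖nu‖⌉₊) * Real.exp (-δ * Real.cosh t)) := by
  have hc := Real.cosh_pos t
  rw [norm_mul, norm_mul, norm_exp_neg_mul_cosh, norm_pow, Complex.norm_real,
    Real.norm_of_nonneg hc.le]
  calc _ ≤ Real.exp (-δ * Real.cosh t) * Real.cosh t ^ n * (2 * Real.cosh t) ^ ⌈‖nu‖⌉₊ := by
        gcongr
        exact (norm_cosh_le_exp_norm _).trans (exp_norm_mul_le_cosh_pow nu ht)
    _ = _ := by ring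

lemma continuous_besselKMoment_integrand (nu : ℂ) (n : ℕ) (z : ℂ) :
    Continuous fun t : ℝ => Complex.exp (-z * (Real.cosh t : ℂ)) * (Real.cosh t : ℂ) ^ n *
      Complex.cosh (nu * (t : ℂ)) := by
  have := Real.continuous_cosh
  have := Complex.continuous_cosh
  fun_prop

lemma integrableOn_besselKMoment (nu : ℂ) (n : ℕ) {z : ℂ} (hz : 0 < z.re) :
    IntegrableOn (fun t : ℝ => Complex.exp (-z * (Real.cosh t : ℂ)) * (Real.cosh t : ℂ) ^ n *
      Complex.cosh (nu * (t : ℂ))) (Ioi 0) := by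
  refine Integrable.mono' ((integrableOn_cosh_pow_mul_exp (n + ⌈‖nu‖⌉₊) hz).const_mul
    (2 ^ ⌈‖nu‖⌉₊)) (continuous_besselKMoment_integrand nu n z).aestronglyMeasurable ?_
  filter_upwards [ae_restrict_mem measurableSet_Ioi] with t ht
  exact norm_besselKMoment_integrand_le nu n le_rfl (le_of_lt ht)

lemma hasDerivAt_besselKMoment (nu : ℂ) (n : ℕ) {z : ℂ} (hz : 0 < z.re) :
    HasDerivAt (besselKMoment nu n) (-besselKMoment nu (n + 1) z) z := by
  have hs : {w : ℂ | z.re / 2 < w.re} ∈ nhds z :=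
    (isOpen_lt continuous_const Complex.continuous_re).mem_nhds (half_lt_self hz)
  have h := (hasDerivAt_integral_of_dominated_loc_of_deriv_le (μ := volume.restrict (Ioi (0:ℝ)))
    (F := fun w t => Complex.exp (-w * (Real.cosh t : ℂ)) * (Real.cosh t : ℂ) ^ n *
      Complex.cosh (nu * (t : ℂ)))
    (F' := fun w t => -(Complex.exp (-w * (Real.cosh t : ℂ)) * (Real.cosh t : ℂ) ^ (n + 1) *
      Complex.cosh (nu * (t : ℂ))))
    (bound := fun t => 2 ^ ⌈‖nu‖⌉₊ *
      (Real.cosh t ^ (n + 1 + ⌈‖nu‖⌉₊) * Real.exp (-(z.re / 2) * Real.cosh t)))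
    hs (Eventually.of_forall fun w =>
      (continuous_besselKMoment_integrand nu n w).aestronglyMeasurable)
    (integrableOn_besselKMoment nu n hz)
    (continuous_besselKMoment_integrand nu (n + 1) z).neg.aestronglyMeasurable ?_
    ((integrableOn_cosh_pow_mul_exp _ (half_pos hz)).const_mul _) ?_).2
  · rw [integral_neg] at h
    exact h
  · filter_upwards [ae_restrict_mem measurableSet_Ioi] with t ht w hw
    rw [norm_neg]
    exact norm_besselKMoment_integrand_le nu (n + 1) (le_of_lt hw) (le_of_lt ht)
  · refine Eventually.of_forall fun t w _ => ?_
    have h1 : HasDerivAt (fun w : ℂ => -w * (Real.cosh t : ℂ)) (-1 * (Real.cosh t : ℂ)) w :=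
      (hasDerivAt_id w).neg.mul_const _
    convert! ((h1.cexp.mul_const ((Real.cosh t : ℂ) ^ n)).mul_const
      (Complex.cosh (nu * (t : ℂ)))) using 1
    ring

/-- The modified Bessel equation, written with moments. -/
lemma besselKMoment_bessel_equation (nu : ℂ) {z : ℂ} (hz : 0 < z.re) :
    z ^ 2 * besselKMoment nu 2 z - z * besselKMoment nu 1 z
      = (z ^ 2 + nu ^ 2) * besselKMoment nu 0 z := by
  have hint := fun n => integrableOn_besselKMoment nu n hz
  have key := integral_Ioi_of_hasDerivAt_of_tendsto' (a := 0) (m := (0 : ℂ))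
    (f := fun t : ℝ => -z * Complex.sinh t * Complex.exp (-z * (Real.cosh t : ℂ)) *
      Complex.cosh (nu * (t : ℂ)) -
      nu * Complex.exp (-z * (Real.cosh t : ℂ)) * Complex.sinh (nu * (t : ℂ)))
    (f' := fun t : ℝ =>
      z ^ 2 * (Complex.exp (-z * (Real.cosh t : ℂ)) * (Real.cosh t : ℂ) ^ 2 *
        Complex.cosh (nu * (t : ℂ)))
      - z * (Complex.exp (-z * (Real.cosh t : ℂ)) * (Real.cosh t : ℂ) ^ 1 *
        Complex.cosh (nu * (t : ℂ)))
      - (z ^ 2 + nu ^ 2) * (Complex.exp (-z * (Real.cosh t : ℂ)) * (Real.cosh t : ℂ) ^ 0 *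
        Complex.cosh (nu * (t : ℂ)))) ?_ ?_ ?_
  · have h21 := ((hint 2).const_mul (z ^ 2)).sub ((hint 1).const_mul z)
    have key := (integral_sub h21 ((hint 0).const_mul (z ^ 2 + nu ^ 2))).symm.trans key
    rw [integral_sub' ((hint 2).const_mul _) ((hint 1).const_mul _),
      integral_const_mul, integral_const_mul, integral_const_mul] at key
    simp only [Complex.ofReal_zero, mul_zero, Complex.sinh_zero, zero_mul, sub_zero] at key
    exact sub_eq_zero.1 key
  · intro t _
    have hid : HasDerivAt (fun s : ℝ => (s : ℂ)) 1 t := Complex.ofRealCLM.hasDerivAt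
    have hnu : HasDerivAt (fun s : ℝ => nu * (s : ℂ)) (nu * 1) t := hid.const_mul nu
    have hE : HasDerivAt (fun s : ℝ => Complex.exp (-z * (Real.cosh s : ℂ)))
        (Complex.exp (-z * (Real.cosh t : ℂ)) * (-z * (Complex.sinh t * 1))) t := by
      simp only [Complex.ofReal_cosh]
      exact (((Complex.hasDerivAt_cosh _).comp t hid).const_mul (-z)).cexp
    have hsinh : HasDerivAt (fun s : ℝ => Complex.sinh s) (Complex.cosh t * 1) t :=
      (Complex.hasDerivAt_sinh _).comp t hid
    have hcosh_nu : HasDerivAt (fun s : ℝ => Complex.cosh (nu * s))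
        (Complex.sinh (nu * t) * (nu * 1)) t := (Complex.hasDerivAt_cosh _).comp t hnu
    have hsinh_nu : HasDerivAt (fun s : ℝ => Complex.sinh (nu * s))
        (Complex.cosh (nu * t) * (nu * 1)) t := (Complex.hasDerivAt_sinh _).comp t hnu
    have h := (((hsinh.const_mul (-z)).mul hE).mul hcosh_nu).sub ((hE.const_mul nu).mul hsinh_nu)
    convert! h using 1
    have hsq := Complex.cosh_sq (t : ℂ)
    simp only [Pi.mul_apply, Complex.ofReal_cosh]
    linear_combination (z ^ 2 * Complex.exp (-z * Complex.cosh t) * Complex.cosh (nu * t)) * hsq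
  · exact (((hint 2).const_mul _).sub ((hint 1).const_mul _)).sub ((hint 0).const_mul _)
  · have hlim := ((tendsto_cosh_pow_mul_exp (1 + ⌈‖nu‖⌉₊) hz).const_mul
      (‖z‖ * 2 ^ ⌈‖nu‖⌉₊)).add ((tendsto_cosh_pow_mul_exp ⌈‖nu‖⌉₊ hz).const_mul
      (‖nu‖ * 2 ^ ⌈‖nu‖⌉₊))
    simp only [mul_zero, add_zero] at hlim
    refine squeeze_zero_norm' ?_ hlim
    filter_upwards [eventually_ge_atTop 0] with t ht
    have hb := exp_norm_mul_le_cosh_pow nu ht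
    have hs : ‖Complex.sinh (t : ℂ)‖ ≤ Real.cosh t := by
      rw [← Complex.ofReal_sinh, Complex.norm_real,
        Real.norm_of_nonneg (Real.sinh_nonneg_iff.2 ht)]
      exact (Real.sinh_lt_cosh t).le
    have hc := Real.cosh_pos t
    refine (norm_sub_le _ _).trans ?_
    rw [norm_mul, norm_mul, norm_mul, norm_mul, norm_mul, norm_neg, norm_exp_neg_mul_cosh]
    calc _ ≤ ‖z‖ * Real.cosh t * Real.exp (-z.re * Real.cosh t) *
            (2 * Real.cosh t) ^ ⌈‖nu‖⌉₊ +
          ‖nu‖ * Real.exp (-z.re * Real.cosh t) * (2 * Real.cosh t) ^ ⌈‖nu‖⌉₊ := by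
          gcongr
          · exact (norm_cosh_le_exp_norm _).trans hb
          · exact (norm_sinh_le_exp_norm _).trans hb
      _ = _ := by ring

lemma contDiffOn_besselK (nu : ℂ) {n : WithTop ℕ∞} :
    ContDiffOn ℂ n (besselK nu) {z | 0 < z.re} := by
  refine DifferentiableOn.contDiffOn (fun z hz => ?_)
    (isOpen_lt continuous_const Complex.continuous_re)
  have h := hasDerivAt_besselKMoment nu 0 hz
  rw [funext (besselKMoment_zero nu)] at h
  exact h.differentiableAt.differentiableWithinAt

/-- If `z` scales like `x ^ (1/4)`, so does `besselK nu ∘ z` under the Euler operator. -/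
lemma hasDerivAt_besselK_comp (nu : ℂ) {z : ℝ → ℂ} {x : ℝ}
    (hz : HasDerivAt z (z x / (4 * x)) x) (hre : 0 < (z x).re) :
    HasDerivAt (fun y => besselK nu (z y)) (-(z x) * besselKMoment nu 1 (z x) / 4 / x) x := by
  have h := (hasDerivAt_besselKMoment nu 0 hre).scomp x hz
  rw [funext (besselKMoment_zero nu)] at h
  convert! h using 1
  simp only [smul_eq_mul, zero_add]
  ring

lemma hasDerivAt_besselKMoment_one_comp (nu : ℂ) {z : ℝ → ℂ} {x : ℝ}
    (hz : HasDerivAt z (z x / (4 * x)) x) (hre : 0 < (z x).re) :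
    HasDerivAt (fun y => -(z y) * besselKMoment nu 1 (z y) / 4)
      ((nu ^ 2 / 16 + z x ^ 2 / 16) * besselK nu (z x) / x) x := by
  have h := (hz.neg.mul ((hasDerivAt_besselKMoment nu 1 hre).scomp x hz)).div_const 4
  convert! h using 1
  have hB := besselKMoment_bessel_equation nu hre
  rw [besselKMoment_zero] at hB
  simp only [smul_eq_mul, Function.comp, Pi.neg_apply]
  linear_combination -(1 / (16 * (x:ℂ))) * hB

/-- The ordinary derivatives of `f₀` in terms of its iterates `f₁, …, f₄` under the Euler operator. -/
lemma iteratedDeriv_of_euler_chain {f₀ f₁ f₂ f₃ f₄ : ℝ → ℝ}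
    (h₀ : ∀ x, 0 < x → HasDerivAt f₀ (f₁ x / x) x) (h₁ : ∀ x, 0 < x → HasDerivAt f₁ (f₂ x / x) x)
    (h₂ : ∀ x, 0 < x → HasDerivAt f₂ (f₃ x / x) x) (h₃ : ∀ x, 0 < x → HasDerivAt f₃ (f₄ x / x) x)
    {x : ℝ} (hx : 0 < x) :
    deriv f₀ x = f₁ x / x ∧
    iteratedDeriv 2 f₀ x = (f₂ x - f₁ x) / x ^ 2 ∧
    iteratedDeriv 3 f₀ x = (f₃ x - 3 * f₂ x + 2 * f₁ x) / x ^ 3 ∧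
    iteratedDeriv 4 f₀ x = (f₄ x - 6 * f₃ x + 11 * f₂ x - 6 * f₁ x) / x ^ 4 := by
  have step {F g h : ℝ → ℝ} {n : ℕ} {k : ℕ} (hg : ∀ y, 0 < y → iteratedDeriv n F y = g y / y ^ k)
      (hh : ∀ y, 0 < y → HasDerivAt g (h y / y) y) (y : ℝ) (hy : 0 < y) :
      iteratedDeriv (n + 1) F y = (h y - k * g y) / y ^ (k + 1) := by
    have he : iteratedDeriv n F =ᶠ[nhds y] fun y => g y / y ^ k := by
      filter_upwards [lt_mem_nhds hy] with s hs using hg s hs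
    rw [iteratedDeriv_succ, he.deriv_eq, 
      ((hh y hy).fun_div (hasDerivAt_pow k y) (by positivity)).deriv]
    rcases k with _ | k
    · simp
    · simp only [Nat.add_sub_cancel]
      field_simp
      ring
  have e₁ : ∀ y, 0 < y → iteratedDeriv 1 f₀ y = f₁ y / y ^ 1 := fun y hy => by
    rw [iteratedDeriv_one, (h₀ y hy).deriv, pow_one]
  have e₂ := step e₁ h₁
  have e₃ := step e₂ (h := fun y => f₃ y - f₂ y) fun y hy => by
    convert! (h₂ y hy).sub ((h₁ y hy).const_mul _) using 1
    push_cast; ring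
  have e₄ := step e₃ (h := fun y => f₄ y - 3 * f₃ y + 2 * f₂ y) fun y hy => by
    convert! ((h₃ y hy).sub (h₂ y hy)).sub (((h₂ y hy).sub ((h₁ y hy).const_mul _)).const_mul _)
      using 1
    push_cast; ring
  refine ⟨(h₀ x hx).deriv, ?_, ?_, ?_⟩
  · rw [e₂ x hx]; push_cast; ring
  · rw [e₃ x hx]; push_cast; ring
  · rw [e₄ x hx]; push_cast; ring

/-- If `θ² U = (α + η) U`, `θ² V = (α - η) V`, `θ η = η / 2` and `η² = -x / 4` for the Euler
operator `θ = x d/dx`, then `p = Re (U V)` solves `θ⁴ p = θ³ p / 2 + 4 α θ² p - 2 α θ p + x p`. -/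
lemma product_ode {U V U' V' η : ℝ → ℂ} (α : ℝ)
    (hU : ∀ x, 0 < x → HasDerivAt U (U' x / x) x)
    (hU' : ∀ x, 0 < x → HasDerivAt U' ((α + η x) * U x / x) x)
    (hV : ∀ x, 0 < x → HasDerivAt V (V' x / x) x)
    (hV' : ∀ x, 0 < x → HasDerivAt V' ((α - η x) * V x / x) x)
    (hη : ∀ x, 0 < x → HasDerivAt η (η x / 2 / x) x)
    (hη2 : ∀ x, 0 < x → η x ^ 2 = -x / 4) {x : ℝ} (hx : 0 < x) :
    x ^ 3 * iteratedDeriv 4 (fun y => (U y * V y).re) x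
      + (11 / 2) * x ^ 2 * iteratedDeriv 3 (fun y => (U y * V y).re) x
      + x * (11 / 2 - 4 * α) * iteratedDeriv 2 (fun y => (U y * V y).re) x
      + (1 / 2 - 2 * α) * deriv (fun y => (U y * V y).re) x
      - (U x * V x).re = 0 := by
  have re_deriv {f g : ℝ → ℂ} (h : ∀ y : ℝ, 0 < y → HasDerivAt f (g y / y) y) (y : ℝ)
      (hy : 0 < y) : HasDerivAt (fun s => (f s).re) ((fun s => (g s).re) y / y) y := by
    have := Complex.reCLM.hasFDerivAt.comp_hasDerivAt y (h y hy)
    simpa only [Function.comp_def, Complex.reCLM_apply, Complex.div_ofReal_re] using this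
  have H₀ : ∀ y, 0 < y → HasDerivAt (fun y => U y * V y)
      ((fun y => U' y * V y + U y * V' y) y / y) y := fun y hy => by
    convert! (hU y hy).mul (hV y hy) using 1
    ring
  have H₁ : ∀ y, 0 < y → HasDerivAt (fun y => U' y * V y + U y * V' y)
      ((fun y => 2 * α * (U y * V y) + 2 * (U' y * V' y)) y / y) y := fun y hy => by
    convert! ((hU' y hy).mul (hV y hy)).add ((hU y hy).mul (hV' y hy)) using 1
    ring
  have H₂ : ∀ y, 0 < y → HasDerivAt (fun y => 2 * α * (U y * V y) + 2 * (U' y * V' y))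
      ((fun y => 4 * α * (U' y * V y + U y * V' y) + 2 * η y * (U y * V' y - U' y * V y)) y / y)
      y := fun y hy => by
    convert! ((H₀ y hy).const_mul (2 * (α : ℂ))).add (((hU' y hy).mul (hV' y hy)).const_mul 2)
      using 1
    ring
  have H₃ : ∀ y, 0 < y → HasDerivAt
      (fun y => 4 * α * (U' y * V y + U y * V' y) + 2 * η y * (U y * V' y - U' y * V y))
      ((fun y => 4 * α * (2 * α * (U y * V y) + 2 * (U' y * V' y))
        + η y * (U y * V' y - U' y * V y) + y * (U y * V y)) y / y) y := fun y hy => by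
    convert! ((H₁ y hy).const_mul (4 * (α : ℂ))).add (((hη y hy).const_mul 2).mul
      (((hU y hy).mul (hV' y hy)).sub ((hU' y hy).mul (hV y hy)))) using 1
    simp only [Pi.sub_apply, Pi.mul_apply]
    linear_combination 4 * U y * V y / y * hη2 y hy
  obtain ⟨d₁, d₂, d₃, d₄⟩ := iteratedDeriv_of_euler_chain (re_deriv H₀) (re_deriv H₁) (re_deriv H₂)
    (re_deriv H₃) hx
  rw [d₁, d₂, d₃, d₄]
  simp only [mul_assoc, ← Complex.ofReal_ofNat, Complex.add_re, Complex.re_ofReal_mul]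
  field_simp
  ring

/-- The argument `2 (4x)^{1/4} c` of the Bessel functions in the kernel. -/
lemma hasDerivAt_kernel_argument (c : ℂ) {x : ℝ} (hx : 0 < x) :
    HasDerivAt (fun y : ℝ => ((2 * (4 * y) ^ ((1:ℝ) / 4) : ℝ) : ℂ) * c)
      (((2 * (4 * x) ^ ((1:ℝ) / 4) : ℝ) : ℂ) * c / (4 * x)) x := by
  have h4 : HasDerivAt (fun y : ℝ => 4 * y) 4 x := by
    simpa using (hasDerivAt_id x).const_mul (4 : ℝ)
  have hpos : 0 < 4 * x := by positivity
  have h := ((h4.rpow_const (p := (1:ℝ) / 4) (Or.inl hpos.ne')).const_mul 2).ofReal_comp.mul_const c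
  convert! h using 1
  rw [Real.rpow_sub_one hpos.ne']
  push_cast
  have : (x : ℂ) ≠ 0 := by exact_mod_cast hx.ne'
  field_simp

lemma exp_I_pi_div_four :
    0 < (Complex.exp (Complex.I * (Real.pi:ℂ) / 4)).re ∧
    0 < (Complex.exp (-(Complex.I * (Real.pi:ℂ)) / 4)).re ∧
    Complex.exp (Complex.I * (Real.pi:ℂ) / 4) ^ 2 = Complex.I ∧
    Complex.exp (-(Complex.I * (Real.pi:ℂ)) / 4) ^ 2 = -Complex.I := by
  have hcos : 0 < Real.cos (Real.pi / 4) := by rw [Real.cos_pi_div_four]; positivity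
  have e1 : Complex.I * (Real.pi:ℂ) / 4 = ((Real.pi / 4 : ℝ) : ℂ) * Complex.I := by
    push_cast; ring
  have e2 : -(Complex.I * (Real.pi:ℂ)) / 4 = ((-(Real.pi / 4) : ℝ) : ℂ) * Complex.I := by
    push_cast; ring
  refine ⟨?_, ?_, ?_, ?_⟩
  · rwa [e1, Complex.exp_ofReal_mul_I_re]
  · rwa [e2, Complex.exp_ofReal_mul_I_re, Real.cos_neg]
  · rw [← Complex.exp_nat_mul]
    convert! Complex.exp_pi_div_two_mul_I using 2
    push_cast; ring
  · rw [← Complex.exp_nat_mul, ← Complex.exp_neg_pi_div_two_mul_I]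
    congr 1; push_cast; ring

lemma kernel_argument_re_pos {c : ℂ} (hc : 0 < c.re) {x : ℝ} (hx : 0 < x) :
    0 < (((2 * (4 * x) ^ ((1:ℝ) / 4) : ℝ) : ℂ) * c).re := by
  rw [Complex.re_ofReal_mul]
  positivity

lemma contDiffOn_besselK_kernel_argument (nu : ℂ) {c : ℂ} (hc : 0 < c.re) {n : WithTop ℕ∞} :
    ContDiffOn ℝ n (fun x : ℝ => besselK nu (((2 * (4 * x) ^ ((1:ℝ) / 4) : ℝ) : ℂ) * c))
      (Ioi 0) := by
  refine ContDiffOn.comp (g := besselK nu) (t := {z : ℂ | 0 < z.re})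
    ((contDiffOn_besselK nu).restrict_scalars ℝ) ?_ fun x hx => kernel_argument_re_pos hc hx
  intro x hx
  have hr : ContDiffAt ℝ n (fun y : ℝ => 2 * (4 * y) ^ ((1:ℝ) / 4)) x :=
    contDiffAt_const.mul ((contDiffAt_const.mul contDiffAt_id).rpow_const_of_ne
      (by have : 0 < x := hx; positivity))
  exact ((Complex.ofRealCLM.contDiff.contDiffAt.comp x hr).mul contDiffAt_const).contDiffWithinAt

/-- Lemma 2: for each fixed τ, x ↦ 𝒦(x,τ) is four times differentiable on (0,∞)
and satisfies the fourth-order ODE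
x³𝒦⁗ + (11/2)x²𝒦‴ + x(11/2+τ²)𝒦″ + (1/2)(1+τ²)𝒦′ − 𝒦 = 0. -/
theorem kernel_fourth_order_ode (τ : ℝ) :
    ContDiffOn ℝ 4 (fun x => kernelK x τ) (Set.Ioi 0) ∧
    ∀ x : ℝ, 0 < x →
      x^3 * iteratedDeriv 4 (fun y => kernelK y τ) x
      + (11/2) * x^2 * iteratedDeriv 3 (fun y => kernelK y τ) x
      + x * (11/2 + τ^2) * iteratedDeriv 2 (fun y => kernelK y τ) x
      + (1/2) * (1 + τ^2) * deriv (fun y => kernelK y τ) x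
      - kernelK x τ = 0 := by
  obtain ⟨hc, hd, hc2, hd2⟩ := exp_I_pi_div_four
  unfold kernelK
  set c := Complex.exp (Complex.I * (Real.pi:ℂ) / 4)
  set d := Complex.exp (-(Complex.I * (Real.pi:ℂ)) / 4)
  set nu : ℂ := 2 * Complex.I * (τ:ℂ) with hnu
  have hnu2 : nu ^ 2 / 16 = ((-τ ^ 2 / 4 : ℝ) : ℂ) := by
    rw [hnu, mul_pow, mul_pow, Complex.I_sq]
    push_cast
    ring
  refine ⟨Complex.reCLM.contDiff.comp_contDiffOn
    ((contDiffOn_besselK_kernel_argument nu hc).mul (contDiffOn_besselK_kernel_argument nu hd)),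
    fun x hx => ?_⟩
  set r : ℝ → ℂ := fun y => ((2 * (4 * y) ^ ((1:ℝ) / 4) : ℝ) : ℂ) with hr
  have h := product_ode (U := fun y => besselK nu (r y * c)) (V := fun y => besselK nu (r y * d))
    (U' := fun y => -(r y * c) * besselKMoment nu 1 (r y * c) / 4)
    (V' := fun y => -(r y * d) * besselKMoment nu 1 (r y * d) / 4)
    (η := fun y => (r y * c) ^ 2 / 16) (-τ ^ 2 / 4)
    (fun y hy => hasDerivAt_besselK_comp nu (z := fun y => r y * c)
      (hasDerivAt_kernel_argument c hy) (kernel_argument_re_pos hc hy))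
    (fun y hy => by
      have := hasDerivAt_besselKMoment_one_comp nu (z := fun y => r y * c)
        (hasDerivAt_kernel_argument c hy) (kernel_argument_re_pos hc hy)
      rwa [hnu2] at this)
    (fun y hy => hasDerivAt_besselK_comp nu (z := fun y => r y * d)
      (hasDerivAt_kernel_argument d hy) (kernel_argument_re_pos hd hy))
    (fun y hy => by
      have := hasDerivAt_besselKMoment_one_comp nu (z := fun y => r y * d)
        (hasDerivAt_kernel_argument d hy) (kernel_argument_re_pos hd hy)
      have hcd : (r y * d) ^ 2 / 16 = -((r y * c) ^ 2 / 16) := by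
        rw [mul_pow, mul_pow, hc2, hd2]; ring
      rwa [hnu2, hcd, ← sub_eq_add_neg] at this)
    (fun y hy => by
      have := ((hasDerivAt_kernel_argument c hy).pow 2).div_const 16
      convert! this using 1
      simp only [hr]
      push_cast
      ring)
    (fun y hy => by
      have h4 : ((4 * y) ^ ((1:ℝ) / 4)) ^ 4 = 4 * y := by
        rw [← Real.rpow_natCast, ← Real.rpow_mul (by positivity)]
        norm_num
      have hr4 : r y ^ 4 = 64 * y := by
        simp only [hr]
        rw [← Complex.ofReal_pow, mul_pow, h4]
        push_cast
        ring
      rw [mul_pow, hc2]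
      linear_combination (-1 / 256 : ℂ) * hr4 + r y ^ 4 / 256 * Complex.I_sq) hx
  linear_combination h
end

section
/- Let p > 1, q = p/(p−1), ν < 1, and let f be measurable on (0,∞) with ‖f‖_{ν,p} < ∞. Then the index transform (F f)(τ) = ∫_0^∞ 𝒦(x,τ)·f(x) dx tends to 0 as τ → +∞. -/
open MeasureTheory Set Filter Asymptotics

open scoped FourierTransform in
/-- The Riemann–Lebesgue lemma in cosine form on a half line. -/
theorem tendsto_setIntegral_mul_cosh_I_zero (g : ℝ → ℂ) (hg : IntegrableOn g (Ioi 0)) :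
    Tendsto (fun τ : ℝ => ∫ t in Ioi (0:ℝ), g t * Complex.cosh (2 * Complex.I * (τ:ℂ) * (t:ℂ)))
      atTop (nhds 0) := by
  have key := Real.tendsto_integral_exp_smul_cocompact ((Ioi (0:ℝ)).indicator g)
  have hpos : Tendsto (fun τ : ℝ => τ / Real.pi) atTop (cocompact ℝ) :=
    (tendsto_id.atTop_div_const Real.pi_pos).mono_right atTop_le_cocompact
  have hneg : Tendsto (fun τ : ℝ => -(τ / Real.pi)) atTop (cocompact ℝ) :=
    (tendsto_neg_atTop_atBot.comp
      (tendsto_id.atTop_div_const Real.pi_pos)).mono_right atBot_le_cocompact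
  have hsum := ((key.comp hpos).add (key.comp hneg)).const_mul (1 / 2 : ℂ)
  rw [add_zero, mul_zero] at hsum
  refine hsum.congr fun τ => ?_
  have hind : ∀ w : ℝ, (∫ v : ℝ, 𝐞 (-(v * w)) • (Ioi (0:ℝ)).indicator g v) =
      ∫ v in Ioi (0:ℝ), 𝐞 (-(v * w)) • g v := fun w => by
    rw [← integral_indicator measurableSet_Ioi]
    congr 1
    ext v
    by_cases hv : v ∈ Ioi (0:ℝ) <;> simp [hv]
  have hint : ∀ w : ℝ, IntegrableOn (fun v : ℝ => 𝐞 (-(v * w)) • g v) (Ioi 0) := fun w => by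
    refine hg.norm.mono' ?_ (by simp)
    refine AEStronglyMeasurable.smul (f := fun v : ℝ => 𝐞 (-(v * w))) ?_ hg.1
    exact (Real.continuous_fourierChar.comp (by fun_prop)).aestronglyMeasurable
  simp only [Function.comp_apply, hind]
  rw [← integral_add (hint _) (hint _), ← integral_const_mul]
  refine integral_congr_ae (Eventually.of_forall fun t => ?_)
  have hpi : (Real.pi : ℂ) ≠ 0 := by exact_mod_cast Real.pi_ne_zero
  simp only [Circle.smul_def, Real.fourierChar_apply, smul_eq_mul, Complex.cosh]
  have e1 : ((2 * Real.pi * -(t * (τ / Real.pi)) : ℝ) : ℂ) * Complex.I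
      = -(2 * Complex.I * τ * t) := by
    push_cast; field_simp
  have e2 : ((2 * Real.pi * -(t * -(τ / Real.pi)) : ℝ) : ℂ) * Complex.I
      = 2 * Complex.I * τ * t := by
    push_cast; field_simp
  rw [e1, e2]
  ring

theorem norm_cosh_two_I_mul_le_one (τ t : ℝ) :
    ‖Complex.cosh (2 * Complex.I * (τ:ℂ) * (t:ℂ))‖ ≤ 1 := by
  have : (2 * Complex.I * (τ:ℂ) * (t:ℂ)) = ((2 * τ * t : ℝ) : ℂ) * Complex.I := by
    push_cast; ring
  rw [this, Complex.cosh_mul_I, ← Complex.ofReal_cos, Complex.norm_real]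
  exact Real.abs_cos_le_one _

theorem exp_neg_le_mul_rpow_neg {a u : ℝ} (ha : 0 < a) (hu : 0 < u) :
    Real.exp (-u) ≤ a ^ a * u ^ (-a) := by
  have h1 : u / a ≤ Real.exp (u / a) := by linarith [Real.add_one_le_exp (u / a)]
  have h2 : (u / a) ^ a ≤ Real.exp u := by
    calc (u / a) ^ a ≤ (Real.exp (u / a)) ^ a := Real.rpow_le_rpow (by positivity) h1 ha.le
      _ = Real.exp u := by rw [← Real.exp_mul, div_mul_cancel₀ _ ha.ne']
  rw [Real.div_rpow hu.le ha.le, div_le_iff₀ (by positivity)] at h2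
  rw [Real.exp_neg, Real.rpow_neg hu.le, ← div_eq_mul_inv, le_div_iff₀ (by positivity),
    inv_mul_le_iff₀ (Real.exp_pos u)]
  exact h2

theorem norm_exp_neg_mul_cosh_le {a : ℝ} (ha : 0 < a) {z : ℂ} (hz : 0 < z.re) (t : ℝ) :
    ‖Complex.exp (-z * (Real.cosh t : ℂ))‖ ≤
      a ^ a * 2 ^ a * z.re ^ (-a) * Real.exp (-a * t) := by
  have hre : (-z * (Real.cosh t : ℂ)).re = -(z.re * Real.cosh t) := by
    rw [Complex.re_mul_ofReal, Complex.neg_re, neg_mul]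
  rw [Complex.norm_exp, hre]
  have hcosh : Real.exp t / 2 ≤ Real.cosh t := by
    rw [Real.cosh_eq]; linarith [Real.exp_pos (-t)]
  calc Real.exp (-(z.re * Real.cosh t)) ≤ Real.exp (-(z.re * (Real.exp t / 2))) := by gcongr
    _ ≤ a ^ a * (z.re * (Real.exp t / 2)) ^ (-a) := exp_neg_le_mul_rpow_neg ha (by positivity)
    _ = _ := by
      rw [Real.mul_rpow hz.le (by positivity), Real.div_rpow (by positivity) (by positivity),
        ← Real.exp_mul, Real.rpow_neg (by norm_num : (0:ℝ) ≤ 2), div_inv_eq_mul,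
        show t * -a = -a * t by ring]
      ring

theorem integrableOn_exp_neg_mul_cosh {z : ℂ} (hz : 0 < z.re) :
    IntegrableOn (fun t : ℝ => Complex.exp (-z * (Real.cosh t : ℂ))) (Ioi 0) := by
  refine ((exp_neg_integrableOn_Ioi 0 one_pos).const_mul
    ((1:ℝ) ^ (1:ℝ) * 2 ^ (1:ℝ) * z.re ^ (-(1:ℝ)))).mono' ?_
    (Eventually.of_forall fun t => norm_exp_neg_mul_cosh_le one_pos hz t)
  exact (by fun_prop : Continuous fun t : ℝ =>
    Complex.exp (-z * (Real.cosh t : ℂ))).aestronglyMeasurable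

theorem tendsto_besselK_two_I_mul {z : ℂ} (hz : 0 < z.re) :
    Tendsto (fun τ : ℝ => besselK (2 * Complex.I * (τ:ℂ)) z) atTop (nhds 0) :=
  tendsto_setIntegral_mul_cosh_I_zero _ (integrableOn_exp_neg_mul_cosh hz)

theorem exists_norm_besselK_le {a : ℝ} (ha : 0 < a) :
    ∃ C : ℝ, 0 ≤ C ∧ ∀ (z : ℂ) (τ : ℝ), 0 < z.re →
      ‖besselK (2 * Complex.I * (τ:ℂ)) z‖ ≤ C * z.re ^ (-a) := by
  refine ⟨a ^ a * 2 ^ a * ∫ t in Ioi (0:ℝ), Real.exp (-a * t),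
    mul_nonneg (by positivity) (integral_nonneg fun t => (Real.exp_pos _).le),
    fun z τ hz => ?_⟩
  have h := norm_integral_le_of_norm_le
    (f := fun t : ℝ => Complex.exp (-z * (Real.cosh t : ℂ)) *
      Complex.cosh (2 * Complex.I * (τ:ℂ) * (t:ℂ)))
    ((exp_neg_integrableOn_Ioi 0 ha).const_mul (a ^ a * 2 ^ a * z.re ^ (-a)))
    (Eventually.of_forall fun t => by
      rw [norm_mul]
      exact (mul_le_of_le_one_right (norm_nonneg _) (norm_cosh_two_I_mul_le_one τ t)).trans
        (norm_exp_neg_mul_cosh_le ha hz t))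
  rw [integral_const_mul] at h
  unfold besselK
  linarith

theorem measurable_besselK (ν : ℂ) : Measurable (besselK ν) := by
  have h : StronglyMeasurable (Function.uncurry fun (z : ℂ) (t : ℝ) =>
      Complex.exp (-z * (Real.cosh t : ℂ)) * Complex.cosh (ν * (t : ℂ))) := by
    refine Continuous.stronglyMeasurable ?_
    simp only [Function.uncurry_def]
    fun_prop
  exact (h.integral_prod_right (ν := volume.restrict (Ioi (0:ℝ)))).measurable

theorem measurable_kernelK (τ : ℝ) : Measurable fun x => kernelK x τ := by
  have hK := measurable_besselK (2 * Complex.I * (τ:ℂ))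
  unfold kernelK
  refine Complex.measurable_re.comp (Measurable.mul (hK.comp ?_) (hK.comp ?_)) <;> fun_prop

theorem rpow_le_re_kernel_arg {x θ : ℝ} (hx : 0 < x) (hθ : Real.cos θ = √2 / 2) :
    x ^ ((1:ℝ)/4) ≤
      (((2 * (4*x) ^ ((1:ℝ)/4) : ℝ) : ℂ) * Complex.exp ((θ : ℂ) * Complex.I)).re := by
  rw [Complex.re_ofReal_mul, Complex.exp_ofReal_mul_I_re, hθ]
  have h1 : x ^ ((1:ℝ)/4) ≤ (4*x) ^ ((1:ℝ)/4) :=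
    Real.rpow_le_rpow hx.le (by linarith) (by norm_num)
  have h2 : (1:ℝ) ≤ √2 := Real.one_le_sqrt.2 (by norm_num)
  have h3 : 0 ≤ (4*x) ^ ((1:ℝ)/4) := by positivity
  nlinarith

theorem rpow_le_re_kernel_arg_left {x : ℝ} (hx : 0 < x) : x ^ ((1:ℝ)/4) ≤
    (((2 * (4*x) ^ ((1:ℝ)/4) : ℝ) : ℂ) * Complex.exp (Complex.I * (Real.pi:ℂ) / 4)).re := by
  have h := rpow_le_re_kernel_arg hx Real.cos_pi_div_four
  rwa [show ((Real.pi / 4 : ℝ) : ℂ) * Complex.I = Complex.I * (Real.pi:ℂ) / 4 by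
    push_cast; ring] at h

theorem rpow_le_re_kernel_arg_right {x : ℝ} (hx : 0 < x) : x ^ ((1:ℝ)/4) ≤
    (((2 * (4*x) ^ ((1:ℝ)/4) : ℝ) : ℂ) * Complex.exp (-(Complex.I * (Real.pi:ℂ)) / 4)).re := by
  have h := rpow_le_re_kernel_arg (θ := -(Real.pi / 4)) hx
    (by rw [Real.cos_neg, Real.cos_pi_div_four])
  rwa [show ((-(Real.pi / 4) : ℝ) : ℂ) * Complex.I = -(Complex.I * (Real.pi:ℂ)) / 4 by
    push_cast; ring] at h

theorem tendsto_kernelK {x : ℝ} (hx : 0 < x) : Tendsto (kernelK x) atTop (nhds 0) := by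
  have hpos : 0 < x ^ ((1:ℝ)/4) := by positivity
  have h := (tendsto_besselK_two_I_mul (hpos.trans_le (rpow_le_re_kernel_arg_left hx))).mul
    (tendsto_besselK_two_I_mul (hpos.trans_le (rpow_le_re_kernel_arg_right hx)))
  rw [mul_zero] at h
  exact (Complex.continuous_re.tendsto 0).comp h

theorem exists_abs_kernelK_le {b : ℝ} (hb : 0 < b) :
    ∃ C : ℝ, 0 ≤ C ∧ ∀ x τ : ℝ, 0 < x → |kernelK x τ| ≤ C * x ^ (-b) := by
  obtain ⟨C, hC, hK⟩ := exists_norm_besselK_le (a := 2 * b) (by positivity)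
  refine ⟨C * C, mul_nonneg hC hC, fun x τ hx => ?_⟩
  have hpos : 0 < x ^ ((1:ℝ)/4) := by positivity
  have bound : ∀ z : ℂ, x ^ ((1:ℝ)/4) ≤ z.re →
      ‖besselK (2 * Complex.I * (τ:ℂ)) z‖ ≤ C * x ^ (-b / 2) := fun z hz => by
    refine (hK z τ (hpos.trans_le hz)).trans (mul_le_mul_of_nonneg_left ?_ hC)
    refine (Real.rpow_le_rpow_of_nonpos hpos hz (by linarith)).trans_eq ?_
    rw [← Real.rpow_mul hx.le]
    congr 1; ring
  refine (Complex.abs_re_le_norm _).trans ?_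
  rw [norm_mul]
  refine (mul_le_mul (bound _ (rpow_le_re_kernel_arg_left hx))
    (bound _ (rpow_le_re_kernel_arg_right hx)) (norm_nonneg _) (by positivity)).trans_eq ?_
  rw [mul_mul_mul_comm, ← Real.rpow_add hx]
  congr 2; ring

/-- Young's inequality with power weights. -/
theorem rpow_neg_mul_le_young {p q : ℝ} (hpq : p.HolderConjugate q) (ν b : ℝ) {x y : ℝ}
    (hx : 0 < x) (hy : 0 ≤ y) :
    x ^ (-b) * y ≤ y ^ p * x ^ (ν*p - 1) / p + x ^ (q * (1/p - ν - b)) / q := by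
  have h := Real.young_inequality_of_nonneg (a := y * x ^ (ν - 1/p)) (b := x ^ (1/p - ν - b))
    (by positivity) (by positivity) hpq
  have e1 : y * x ^ (ν - 1/p) * x ^ (1/p - ν - b) = x ^ (-b) * y := by
    rw [mul_assoc, ← Real.rpow_add hx, mul_comm]
    congr 2; ring
  have e2 : (y * x ^ (ν - 1/p)) ^ p = y ^ p * x ^ (ν*p - 1) := by
    rw [Real.mul_rpow hy (by positivity), ← Real.rpow_mul hx.le]
    congr 2
    have := hpq.ne_zero
    field_simp
  have e3 : (x ^ (1/p - ν - b)) ^ q = x ^ (q * (1/p - ν - b)) := by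
    rw [← Real.rpow_mul hx.le, mul_comm]
  rwa [e1, e2, e3] at h

theorem integrableOn_rpow_neg_mul_abs {p q ν b : ℝ} (hpq : p.HolderConjugate q)
    {f : ℝ → ℝ} (hf : Measurable f) {s : Set ℝ} (hs : MeasurableSet s) (hs0 : s ⊆ Ioi 0)
    (hfs : IntegrableOn (fun x => |f x| ^ p * x ^ (ν*p - 1)) s)
    (hps : IntegrableOn (fun x : ℝ => x ^ (q * (1/p - ν - b))) s) :
    IntegrableOn (fun x => x ^ (-b) * |f x|) s := by
  refine ((hfs.div_const p).add (hps.div_const q)).mono'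
    (by fun_prop) ?_
  refine (ae_restrict_iff' hs).2 (Eventually.of_forall fun x hx => ?_)
  have hx0 : 0 < x := hs0 hx
  rw [Real.norm_of_nonneg (by positivity)]
  exact rpow_neg_mul_le_young hpq ν b hx0 (abs_nonneg _)

/-- Theorem 2 (vanishing at infinity of the index transform (1.1)). -/
theorem indexF_tendsto_zero (p q ν : ℝ) (hp : 1 < p) (hq : q = p/(p-1)) (hν : ν < 1)
    (f : ℝ → ℝ) (hf : Measurable f)
    (hfin : MeasureTheory.IntegrableOn (fun x => |f x| ^ p * x ^ (ν*p - 1)) (Set.Ioi 0)) :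
    Tendsto (indexF f) atTop (nhds 0) := by
  have hpq : p.HolderConjugate q := hq ▸ Real.HolderConjugate.conjExponent hp
  have hp0 := hpq.pos
  have hq0 := hpq.symm.pos
  have hexp : ∀ b : ℝ, q * (1/p - ν - b) = -1 + q * (1 - ν - b) := fun b => by
    have h := hpq.inv_add_inv_eq_one
    have h' : 1 / p = 1 - q⁻¹ := by rw [one_div]; linarith
    rw [h']
    field_simp
    ring
  set b₁ : ℝ := (1 - ν) / 2 with hb₁
  set b₂ : ℝ := 2 - ν with hb₂
  obtain ⟨C₁, hC₁, hK₁⟩ := exists_abs_kernelK_le (b := b₁) (by linarith)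
  obtain ⟨C₂, hC₂, hK₂⟩ := exists_abs_kernelK_le (b := b₂) (by linarith)
  have hI₁ : IntegrableOn (fun x => x ^ (-b₁) * |f x|) (Ioc 0 1) := by
    refine integrableOn_rpow_neg_mul_abs hpq hf measurableSet_Ioc Ioc_subset_Ioi_self
      (hfin.mono_set Ioc_subset_Ioi_self) ?_
    rw [← intervalIntegrable_iff_integrableOn_Ioc_of_le zero_le_one]
    refine intervalIntegral.intervalIntegrable_rpow' ?_
    have : 0 < q * (1 - ν - b₁) := mul_pos hq0 (by linarith)
    linarith [hexp b₁]
  have hI₂ : IntegrableOn (fun x => x ^ (-b₂) * |f x|) (Ioi 1) := by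
    have hsub : Ioi (1:ℝ) ⊆ Ioi 0 := Ioi_subset_Ioi zero_le_one
    refine integrableOn_rpow_neg_mul_abs hpq hf measurableSet_Ioi hsub (hfin.mono_set hsub) ?_
    refine integrableOn_Ioi_rpow_of_lt ?_ one_pos
    have : 0 < q * (b₂ - (1 - ν)) := mul_pos hq0 (by linarith)
    linarith [hexp b₂]
  have hmin : ∀ x : ℝ, 0 < x → 0 ≤ min (C₁ * x ^ (-b₁)) (C₂ * x ^ (-b₂)) := fun x hx => by
    positivity
  have hbound : IntegrableOn
      (fun x => min (C₁ * x ^ (-b₁)) (C₂ * x ^ (-b₂)) * |f x|) (Ioi 0) := by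
    rw [← Ioc_union_Ioi_eq_Ioi (zero_le_one' ℝ)]
    refine IntegrableOn.union ((hI₁.const_mul C₁).mono' (by fun_prop) ?_)
      ((hI₂.const_mul C₂).mono' (by fun_prop) ?_)
    · refine (ae_restrict_iff' measurableSet_Ioc).2 (Eventually.of_forall fun x hx => ?_)
      rw [Real.norm_of_nonneg (mul_nonneg (hmin x hx.1) (abs_nonneg _)), ← mul_assoc]
      exact mul_le_mul_of_nonneg_right (min_le_left _ _) (abs_nonneg _)
    · refine (ae_restrict_iff' measurableSet_Ioi).2 (Eventually.of_forall fun x hx => ?_)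
      rw [Real.norm_of_nonneg (mul_nonneg (hmin x (one_pos.trans hx)) (abs_nonneg _)),
        ← mul_assoc]
      exact mul_le_mul_of_nonneg_right (min_le_right _ _) (abs_nonneg _)
  have hlim := tendsto_integral_filter_of_dominated_convergence (l := atTop)
    (F := fun τ x => kernelK x τ * f x) (f := fun _ => (0:ℝ)) _
    (Eventually.of_forall fun τ => ((measurable_kernelK τ).mul hf).aestronglyMeasurable)
    (Eventually.of_forall fun τ => (ae_restrict_iff' measurableSet_Ioi).2
      (Eventually.of_forall fun x hx => by
        rw [norm_mul, Real.norm_eq_abs, Real.norm_eq_abs]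
        exact mul_le_mul_of_nonneg_right (le_min (hK₁ x τ hx) (hK₂ x τ hx)) (abs_nonneg _)))
    hbound
    ((ae_restrict_iff' measurableSet_Ioi).2 (Eventually.of_forall fun x hx => by
      simpa using (tendsto_kernelK hx).mul_const (f x)))
  rw [integral_zero] at hlim
  exact hlim
end
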